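/- Let f : (k+1)^V → ℝ be a nonnegative monotone k-submodular function with f(0) = 0 and let c be a cost function on V. Let o ∈ (k+1)^V and let 0 = s^{(0)} ⪯ s^{(1)} ⪯ … ⪯ s^{(m)} = s be a greedy sequence relative to o. If c(s) = c(o), then 2·f(s) ≥ f(o). -/

import Mathlib

open Finset

section KSubmodularDefs

variable {V : Type*} [Fintype V] [DecidableEq V] {k : ℕ}

/-- The support of a `k`-tuple `x : V → Fin (k+1)` (value `0` means "not selected"). -/
def ksupp (x : V → Fin (k+1)) : Finset V := Finset.univ.filter fun e => x e ≠ 0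

/-- The meet `x ⊓ y`. -/
def kinf (x y : V → Fin (k+1)) : V → Fin (k+1) :=
  fun e => if x e = y e then x e else 0

/-- The join `x ⊔ y`. -/
def ksup (x y : V → Fin (k+1)) : V → Fin (k+1) :=
  fun e => if y e = 0 ∨ y e = x e then x e else if x e = 0 then y e else 0

/-- `f` is `k`-submodular. -/
def KSubmodular (f : (V → Fin (k+1)) → ℝ) : Prop :=
  ∀ x y : V → Fin (k+1), f (ksup x y) + f (kinf x y) ≤ f x + f y

/-- The partial order `x ⪯ y` on `(k+1)^V`. -/
def kle (x y : V → Fin (k+1)) : Prop := ∀ e : V, x e = 0 ∨ x e = y e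

/-- `f` is monotone with respect to `⪯`. -/
def KMonotone (f : (V → Fin (k+1)) → ℝ) : Prop :=
  ∀ x y : V → Fin (k+1), kle x y → f x ≤ f y

/-- The marginal gain `Δ_{e,j}(x)` of assigning element `e` to component `j`. -/
def margin (f : (V → Fin (k+1)) → ℝ) (x : V → Fin (k+1)) (e : V) (j : Fin (k+1)) : ℝ :=
  f (Function.update x e j) - f x

/-- The total cost `c(x)` of a tuple. -/
def kcost (c : V → ℝ) (x : V → Fin (k+1)) : ℝ := ∑ e ∈ ksupp x, c e

/-- One step of a greedy sequence relative to `o`: pick `e ∉ supp x` and `j ∈ {1,…,k}`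
maximizing the marginal gain over components (a), and with marginal density at least that of
every pair `(e', j')` with `e' ∈ supp o \ supp x` (b). -/
def GreedyStep (f : (V → Fin (k+1)) → ℝ) (c : V → ℝ) (o : V → Fin (k+1))
    (x x' : V → Fin (k+1)) : Prop :=
  ∃ e : V, ∃ j : Fin (k+1), x e = 0 ∧ j ≠ 0 ∧ x' = Function.update x e j ∧
    (∀ j' : Fin (k+1), j' ≠ 0 → margin f x e j' ≤ margin f x e j) ∧
    (∀ e' : V, o e' ≠ 0 → x e' = 0 → ∀ j' : Fin (k+1), j' ≠ 0 →
      margin f x e' j' * c e ≤ margin f x e j * c e')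

/-- `GreedyRun f c B s V0 out`: starting from partial solution `s` with remaining elements `V0`,
the greedy procedure with budget `B` (under some tie-breaking) can terminate with output `out`.
At each step a pair `(e, j)` of maximum marginal density among remaining elements is chosen;
`e` is added (placed in component `j`) iff it fits in the remaining budget, and is removed
from the remaining pool in either case. -/
inductive GreedyRun (f : (V → Fin (k+1)) → ℝ) (c : V → ℝ) (B : ℝ) :
    (V → Fin (k+1)) → Finset V → (V → Fin (k+1)) → Prop where
  | done (s : V → Fin (k+1)) : GreedyRun f c B s ∅ s
  | take (s : V → Fin (k+1)) (V0 : Finset V) (e : V) (j : Fin (k+1))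
      (out : V → Fin (k+1)) (he : e ∈ V0) (hj : j ≠ 0)
      (hbest : ∀ e' ∈ V0, ∀ j' : Fin (k+1), j' ≠ 0 →
        margin f s e' j' / c e' ≤ margin f s e j / c e)
      (hfit : kcost c s + c e ≤ B)
      (hrest : GreedyRun f c B (Function.update s e j) (V0.erase e) out) :
      GreedyRun f c B s V0 out
  | skip (s : V → Fin (k+1)) (V0 : Finset V) (e : V) (j : Fin (k+1))
      (out : V → Fin (k+1)) (he : e ∈ V0) (hj : j ≠ 0)
      (hbest : ∀ e' ∈ V0, ∀ j' : Fin (k+1), j' ≠ 0 →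
        margin f s e' j' / c e' ≤ margin f s e j / c e)
      (hnofit : ¬ kcost c s + c e ≤ B)
      (hrest : GreedyRun f c B s (V0.erase e) out) :
      GreedyRun f c B s V0 out

/-- The `k`-multilinear extension of `f`, as a function of `x : V → Fin (k+1) → ℝ`
(only the coordinates `x e j` with `j ≠ 0` are relevant). -/
noncomputable def kext (f : (V → Fin (k+1)) → ℝ) (x : V → Fin (k+1) → ℝ) : ℝ :=
  ∑ s : V → Fin (k+1), f s *
    ∏ e : V,
      (if s e = 0 then 1 - ∑ j ∈ Finset.univ.erase (0 : Fin (k+1)), x e j else x e (s e))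

/-- The partial derivative of `F` with respect to the coordinate `(e, j)` at the point `x`. -/
noncomputable def pderiv (F : (V → Fin (k+1) → ℝ) → ℝ) (e : V) (j : Fin (k+1))
    (x : V → Fin (k+1) → ℝ) : ℝ :=
  deriv (fun t : ℝ => F (Function.update x e (Function.update (x e) j t))) (x e j)

/-- Membership in the domain `Δ_k^V` of the multilinear extension. -/
def inSimplex (x : V → Fin (k+1) → ℝ) : Prop :=
  (∀ e : V, ∀ j : Fin (k+1), j ≠ 0 → 0 ≤ x e j ∧ x e j ≤ 1) ∧
  (∀ e : V, ∑ j ∈ Finset.univ.erase (0 : Fin (k+1)), x e j ≤ 1)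

end KSubmodularDefs

section Greedy

variable {V : Type*} [DecidableEq V] {k : ℕ}

/-- The tuple that agrees with `x` on the support of `x` and with `o` elsewhere. -/
def koverlay (x o : V → Fin (k+1)) : V → Fin (k+1) :=
  fun e => if x e = 0 then o e else x e

theorem koverlay_update {x o : V → Fin (k+1)} {e : V} {j : Fin (k+1)} (hj : j ≠ 0) :
    koverlay (Function.update x e j) o = Function.update (koverlay x o) e j := by
  funext a
  by_cases ha : a = e
  · subst ha
    simp [koverlay, hj]
  · simp [koverlay, ha]

theorem kle_update {x : V → Fin (k+1)} {e : V} (hx : x e = 0) (j : Fin (k+1)) :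
    kle x (Function.update x e j) := by
  intro a
  by_cases ha : a = e
  · subst ha
    exact Or.inl hx
  · simp [ha]

theorem KMonotone.margin_nonneg {f : (V → Fin (k+1)) → ℝ} (hf : KMonotone f)
    {x : V → Fin (k+1)} {e : V} (hx : x e = 0) (j : Fin (k+1)) : 0 ≤ margin f x e j :=
  sub_nonneg.2 (hf _ _ (kle_update hx j))

/-- Marginal gains decrease along `⪯`. -/
theorem KSubmodular.margin_anti {f : (V → Fin (k+1)) → ℝ} (hf : KSubmodular f)
    {x y : V → Fin (k+1)} (hxy : kle x y) {e : V} (he : y e = 0) {j : Fin (k+1)} (hj : j ≠ 0) :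
    margin f y e j ≤ margin f x e j := by
  have hx : x e = 0 := by
    rcases hxy e with h | h
    · exact h
    · rw [h, he]
  have hsup : ksup (Function.update x e j) y = Function.update y e j := by
    funext a
    by_cases ha : a = e
    · subst ha
      simp [ksup, he]
    · have := hxy a
      simp only [ksup, Function.update_of_ne ha]
      grind
  have hinf : kinf (Function.update x e j) y = x := by
    funext a
    by_cases ha : a = e
    · subst ha
      simp [kinf, he, hj, hx]
    · have := hxy a
      simp only [kinf, Function.update_of_ne ha]
      grind
  have h := hf (Function.update x e j) y
  rw [hsup, hinf] at h
  unfold margin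
  linarith

/-- The gain of moving from `x` to `koverlay x o` on a finite set is at most the sum of the
individual marginal gains. -/
theorem KSubmodular.piecewise_le_add_sum_margin {f : (V → Fin (k+1)) → ℝ} (hf : KSubmodular f)
    (x o : V → Fin (k+1)) (T : Finset V) (hT : ∀ e ∈ T, x e = 0 ∧ o e ≠ 0) :
    f (T.piecewise o x) ≤ f x + ∑ e ∈ T, margin f x e (o e) := by
  induction T using Finset.induction_on with
  | empty => simp
  | insert e T he ih =>
    have hins := hT e (mem_insert_self e T)
    have hle : kle x (T.piecewise o x) := by
      intro a
      by_cases ha : a ∈ T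
      · exact Or.inl (hT a (mem_insert_of_mem ha)).1
      · simp [ha]
    have hm := hf.margin_anti hle (e := e) (by simp [he, hins.1]) hins.2
    have ih := ih fun a ha => hT a (mem_insert_of_mem ha)
    rw [piecewise_insert, sum_insert he]
    simp only [margin] at hm ih ⊢
    linarith

/-- A greedy step never decreases `f (koverlay x o) + f x`, and increases it by at least the gain
of the step when the chosen element lies outside the support of `o`. -/
theorem GreedyStep.exists_update [Fintype V] {f : (V → Fin (k+1)) → ℝ} {c : V → ℝ}
    {o x x' : V → Fin (k+1)} (hsub : KSubmodular f) (hmono : KMonotone f)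
    (h : GreedyStep f c o x x') :
    ∃ e j, x e = 0 ∧ j ≠ 0 ∧ x' = Function.update x e j ∧
      (∀ a, o a ≠ 0 → x a = 0 → margin f x a (o a) * c e ≤ margin f x e j * c a) ∧
      f (koverlay x o) + f x + (if o e = 0 then margin f x e j else 0)
        ≤ f (koverlay x' o) + f x' := by
  obtain ⟨e, j, hx, hj, rfl, hbest, hdens⟩ := h
  refine ⟨e, j, hx, hj, rfl, fun a ho ha => hdens a ho ha _ ho, ?_⟩
  rw [koverlay_update hj]
  split_ifs with ho
  · have := hmono _ _ (kle_update (x := koverlay x o) (e := e) (by simp [koverlay, hx, ho]) j)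
    unfold margin
    linarith
  · have hle : kle x (Function.update (koverlay x o) e 0) := by
      intro a
      by_cases ha : a = e
      · subst ha
        exact Or.inl hx
      · simp only [koverlay, Function.update_of_ne ha]
        grind
    have h1 := hsub.margin_anti hle (e := e) (by simp) ho
    have h2 := hbest _ ho
    have h3 := hmono.margin_nonneg (x := Function.update (koverlay x o) e 0) (e := e) (by simp) j
    have h4 : Function.update (koverlay x o) e (o e) = koverlay x o := by
      rw [Function.update_eq_self_iff]
      simp [koverlay, hx]
    simp only [margin, Function.update_idem, h4] at h1 h2 h3
    linarith

theorem ksupp_update [Fintype V] (x : V → Fin (k+1)) (e : V) {j : Fin (k+1)} (hj : j ≠ 0) :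
    ksupp (Function.update x e j) = insert e (ksupp x) := by
  ext a
  by_cases ha : a = e
  · subst ha
    simp [ksupp, hj]
  · simp [ksupp, ha]

/-- The greedy invariant: `G` is the total gain of the steps that choose an element outside the
support of `o`. -/
theorem exists_greedy_gain [Fintype V] {f : (V → Fin (k+1)) → ℝ} (hsub : KSubmodular f)
    (hmono : KMonotone f) (hzero : f (fun _ => 0) = 0) {c : V → ℝ} (hc : ∀ e, 0 < c e)
    (o : V → Fin (k+1)) (s : ℕ → V → Fin (k+1)) (h0 : s 0 = fun _ => 0) (m : ℕ)
    (hstep : ∀ i < m, GreedyStep f c o (s i) (s (i+1))) :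
    ∃ G : ℝ, 0 ≤ G ∧ f o + G ≤ f (koverlay (s m) o) + f (s m) ∧
      ∀ a, o a ≠ 0 → s m a = 0 →
        margin f (s m) a (o a) * ∑ e ∈ ksupp (s m) \ ksupp o, c e ≤ G * c a := by
  induction m with
  | zero =>
    refine ⟨0, le_rfl, ?_, ?_⟩
    · have : koverlay (s 0) o = o := by
        funext a
        simp [koverlay, h0]
      rw [this, h0, hzero]
    · intro a _ _
      simp [h0, ksupp]
  | succ n ih =>
    obtain ⟨G, hG, hf, hd⟩ := ih fun i hi => hstep i (hi.trans n.lt_succ_self)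
    obtain ⟨e, j, hx, hj, hs, hdens, hgain⟩ := (hstep n n.lt_succ_self).exists_update hsub hmono
    have hnn := hmono.margin_nonneg hx j
    refine ⟨G + if o e = 0 then margin f (s n) e j else 0, ?_, by linarith, ?_⟩
    · split_ifs <;> linarith
    intro a ho ha
    have hle : kle (s n) (s (n+1)) := hs ▸ kle_update hx j
    have hxa : s n a = 0 := by
      rcases hle a with h | h
      · exact h
      · rw [h, ha]
    have hanti := hsub.margin_anti hle ha ho
    have hsum : ∑ b ∈ ksupp (s (n+1)) \ ksupp o, c b
        = ∑ b ∈ ksupp (s n) \ ksupp o, c b + if o e = 0 then c e else 0 := by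
      rw [hs, ksupp_update _ _ hj]
      split_ifs with hoe
      · rw [insert_sdiff_of_notMem _ (by simp [ksupp, hoe]),
          sum_insert (by simp [ksupp, hx]), add_comm]
      · rw [insert_sdiff_of_mem _ (by simp [ksupp, hoe]), add_zero]
    have hC : 0 ≤ ∑ b ∈ ksupp (s n) \ ksupp o, c b := sum_nonneg fun b _ => (hc b).le
    have h1 := (mul_le_mul_of_nonneg_right hanti hC).trans (hd a ho hxa)
    have h2 := (mul_le_mul_of_nonneg_right hanti (hc e).le).trans (hdens a ho hxa)
    rw [hsum]
    split_ifs <;> linarith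

end Greedy

/-- **Key lemma, monotone case.** If `s` is obtained by a greedy sequence
(relative to `o`) starting from `0`, and `c(s) = c(o)`, then `2·f(s) ≥ f(o)`. -/
theorem greedy_key_lemma_monotone
    {V : Type*} [Fintype V] [DecidableEq V] {k : ℕ} (hk : 1 ≤ k)
    (f : (V → Fin (k+1)) → ℝ)
    (hsub : KSubmodular f) (hmono : KMonotone f)
    (hnonneg : ∀ x : V → Fin (k+1), 0 ≤ f x) (hzero : f (fun _ => 0) = 0)
    (c : V → ℝ) (hc : ∀ e : V, 0 < c e)
    (o : V → Fin (k+1)) (m : ℕ) (s : ℕ → V → Fin (k+1))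
    (h0 : s 0 = fun _ => 0)
    (hstep : ∀ i < m, GreedyStep f c o (s i) (s (i+1)))
    (hcost : kcost c (s m) = kcost c o) :
    f o ≤ 2 * f (s m) := by
  obtain ⟨G, hG, hf, hd⟩ := exists_greedy_gain hsub hmono hzero hc o s h0 m hstep
  set T := ksupp o \ ksupp (s m) with hTdef
  have hT : ∀ e ∈ T, s m e = 0 ∧ o e ≠ 0 := by
    intro e he
    simp only [hTdef, ksupp, mem_sdiff, mem_filter, mem_univ, true_and, not_not] at he
    exact ⟨he.2, he.1⟩
  have hover : koverlay (s m) o = T.piecewise o (s m) := by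
    funext a
    by_cases ha : s m a = 0 <;> by_cases ho : o a = 0 <;>
      simp [koverlay, Finset.piecewise, hTdef, ksupp, ha, ho]
  have hbound := hsub.piecewise_le_add_sum_margin (s m) o T hT
  rw [← hover] at hbound
  suffices h : ∑ e ∈ T, margin f (s m) e (o e) ≤ G by linarith
  have hcostT : ∑ e ∈ ksupp (s m) \ ksupp o, c e = ∑ e ∈ T, c e := by
    have h1 := sum_inter_add_sum_sdiff (ksupp (s m)) (ksupp o) c
    have h2 := sum_inter_add_sum_sdiff (ksupp o) (ksupp (s m)) c
    rw [inter_comm] at h2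
    unfold kcost at hcost
    linarith
  rcases T.eq_empty_or_nonempty with hemp | hne
  · simpa [hemp] using hG
  · have hsum := sum_le_sum fun e he => hd e (hT e he).2 (hT e he).1
    rw [← sum_mul, ← mul_sum, hcostT] at hsum
    exact le_of_mul_le_mul_right hsum (sum_pos (fun e _ => hc e) hne)
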